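/- arXiv:2603.01282 — 4 statements merged into one kernel-verified Lean document; each statement's English description precedes it below -/
import Mathlib

section
/- For all indices 0 ≤ i < j ≤ n−1, the recursively defined value b(i,j) holds if and only if A(i,j) holds and, in case j ≥ i+2, there exists a triangulation of the subpolygon on vertices i, i+1, …, j within A; that is, b(i,j) is true exactly when A(i,j) holds and there is a set T of pairs (k,l) with i ≤ k, k+2 ≤ l ≤ j and (k,l) ≠ (i,j), all chords in T satisfying A, pairwise noncrossing, with |T| = j − i − 2 (for j = i+1 the condition is vacuous and b(i,i+1) is true). -/
/-- Two chords `(i,j)` and `(k,l)`, each written with first coordinate smaller than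
the second, cross iff `i<k<j<l` or `k<i<l<j`. -/
def Crosses (c d : ℕ × ℕ) : Prop :=
  (c.1 < d.1 ∧ d.1 < c.2 ∧ c.2 < d.2) ∨ (d.1 < c.1 ∧ c.1 < d.2 ∧ d.2 < c.2)

/-- `T` is a triangulation of the subpolygon on vertices `i, i+1, …, j` within the
edge set `A`: a finite set of pairs `(k,l)` with `i ≤ k`, `k+2 ≤ l ≤ j`, `(k,l) ≠ (i,j)`,
all satisfying `A`, pairwise noncrossing, with `|T| = j - i - 2`. -/
def IsTriangulationOn (A : ℕ → ℕ → Prop) (i j : ℕ) (T : Finset (ℕ × ℕ)) : Prop :=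
  (∀ c ∈ T, i ≤ c.1 ∧ c.1 + 2 ≤ c.2 ∧ c.2 ≤ j ∧ c ≠ (i, j) ∧ A c.1 c.2) ∧
  (∀ c ∈ T, ∀ d ∈ T, c ≠ d → ¬ Crosses c d) ∧
  T.card = j - i - 2

/-- `b(i,j)` defined by strong recursion on `j - i`: `b(i,i+1) = True`, and for
`j ≥ i+2`, `b(i,j)` holds iff `A(i,j)` holds and there is `i < k < j`
with `b(i,k)` and `b(k,j)`. -/
def bRec (A : ℕ → ℕ → Prop) (i j : ℕ) : Prop :=
  if j ≤ i + 1 then True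
  else A i j ∧ ∃ k, ∃ _ : i < k ∧ k < j, bRec A i k ∧ bRec A k j
termination_by j - i
decreasing_by all_goals omega

/-- `S` is a finite set of pairwise noncrossing chords of the subpolygon on vertices `i, …, j`
within `A`, where the chord `(i, j)` itself is allowed. -/
def IsNoncrossingOn (A : ℕ → ℕ → Prop) (i j : ℕ) (S : Finset (ℕ × ℕ)) : Prop :=
  (∀ c ∈ S, i ≤ c.1 ∧ c.1 + 2 ≤ c.2 ∧ c.2 ≤ j ∧ A c.1 c.2) ∧
  ∀ c ∈ S, ∀ d ∈ S, ¬ Crosses c d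

/-- A noncrossing set of chords other than `(i, j)` splits at some intermediate vertex `k`. -/
theorem IsNoncrossingOn.exists_split {A : ℕ → ℕ → Prop} {i j : ℕ} {S : Finset (ℕ × ℕ)}
    (hS : IsNoncrossingOn A i j S) (hij : i + 2 ≤ j) :
    ∃ k, i < k ∧ k < j ∧ ∀ c ∈ S, c ≠ (i, j) → c.2 ≤ k ∨ k ≤ c.1 := by
  classical
  let P : ℕ → Prop := fun l ↦ l < j ∧ (l = i + 1 ∨ (i, l) ∈ S)
  have hP : P (i + 1) := ⟨by omega, Or.inl rfl⟩
  have hle : i + 1 ≤ j := by omega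
  have hk : P (Nat.findGreatest P j) := Nat.findGreatest_spec hle hP
  have hik : i + 1 ≤ Nat.findGreatest P j := Nat.le_findGreatest hle hP
  have hmax : ∀ l, P l → l ≤ Nat.findGreatest P j :=
    fun l hl ↦ Nat.le_findGreatest hl.1.le hl
  generalize Nat.findGreatest P j = k at hk hik hmax
  refine ⟨k, hik, hk.1, ?_⟩
  rintro ⟨a, b⟩ hc hne
  by_contra! h
  obtain ⟨ha, -, hb, -⟩ := hS.1 _ hc
  simp only at ha hb h
  rcases ha.eq_or_lt with rfl | ha
  · have hbj : b ≠ j := fun hbj ↦ hne (by rw [hbj])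
    exact absurd (hmax b ⟨by omega, Or.inr hc⟩) (by omega)
  · rcases hk.2 with rfl | hmem
    · omega
    · exact hS.2 _ hmem _ hc (Or.inl ⟨ha, h.2, h.1⟩)

/-- A noncrossing set of chords decomposes into noncrossing sets on the two sides of a vertex `k`,
together with at most the chord `(i, j)`. -/
theorem IsNoncrossingOn.exists_decomposition {A : ℕ → ℕ → Prop} {i j : ℕ} {S : Finset (ℕ × ℕ)}
    (hS : IsNoncrossingOn A i j S) (hij : i + 2 ≤ j) :
    ∃ k L R, i < k ∧ k < j ∧ IsNoncrossingOn A i k L ∧ IsNoncrossingOn A k j R ∧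
      (S.erase (i, j)).card ≤ L.card + R.card := by
  classical
  obtain ⟨k, hik, hkj, hk⟩ := hS.exists_split hij
  refine ⟨k, S.filter (fun c ↦ c.2 ≤ k), S.filter (fun c ↦ k ≤ c.1), hik, hkj, ⟨?_, ?_⟩,
    ⟨?_, ?_⟩, ?_⟩
  · intro c hc
    rw [Finset.mem_filter] at hc
    obtain ⟨h₁, h₂, -, h₄⟩ := hS.1 c hc.1
    exact ⟨h₁, h₂, hc.2, h₄⟩
  · exact fun c hc d hd ↦ hS.2 c (Finset.mem_filter.1 hc).1 d (Finset.mem_filter.1 hd).1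
  · intro c hc
    rw [Finset.mem_filter] at hc
    exact ⟨hc.2, (hS.1 c hc.1).2⟩
  · exact fun c hc d hd ↦ hS.2 c (Finset.mem_filter.1 hc).1 d (Finset.mem_filter.1 hd).1
  · refine le_trans (Finset.card_le_card fun c hc ↦ ?_) (Finset.card_union_le _ _)
    obtain ⟨hne, hc⟩ := Finset.mem_erase.1 hc
    simpa [hc] using hk c hc hne

/-- A noncrossing set of chords of the subpolygon on `i, …, j` has at most `j - i - 1` elements. -/
theorem IsNoncrossingOn.card_le {A : ℕ → ℕ → Prop} {i j : ℕ} {S : Finset (ℕ × ℕ)}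
    (hS : IsNoncrossingOn A i j S) : S.card ≤ j - i - 1 := by
  by_cases hij : i + 2 ≤ j
  · obtain ⟨k, L, R, hik, hkj, hL, hR, hcard⟩ := hS.exists_decomposition hij
    have hL' := hL.card_le
    have hR' := hR.card_le
    have := Finset.pred_card_le_card_erase (s := S) (a := (i, j))
    omega
  · have : S = ∅ := Finset.eq_empty_of_forall_notMem fun c hc ↦ by
      have := hS.1 c hc
      omega
    simp [this]
termination_by j - i

/-- A noncrossing set of chords of maximal size contains `(i, j)`. -/
theorem IsNoncrossingOn.mem_of_card_eq {A : ℕ → ℕ → Prop} {i j : ℕ} {S : Finset (ℕ × ℕ)}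
    (hS : IsNoncrossingOn A i j S) (hcard : S.card = j - i - 1) (hij : i + 2 ≤ j) :
    (i, j) ∈ S := by
  by_contra hmem
  obtain ⟨k, L, R, hik, hkj, hL, hR, hle⟩ := hS.exists_decomposition hij
  have hL' := hL.card_le
  have hR' := hR.card_le
  rw [Finset.erase_eq_of_notMem hmem] at hle
  omega

/-- A noncrossing set of chords of maximal size witnesses `bRec`. -/
theorem IsNoncrossingOn.bRec_of_card_eq {A : ℕ → ℕ → Prop} {i j : ℕ} {S : Finset (ℕ × ℕ)}
    (hS : IsNoncrossingOn A i j S) (hcard : S.card = j - i - 1) : bRec A i j := by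
  rw [bRec]
  split_ifs with hij
  have hmem := hS.mem_of_card_eq hcard (by omega)
  obtain ⟨k, L, R, hik, hkj, hL, hR, hle⟩ := hS.exists_decomposition (by omega)
  have hL' := hL.card_le
  have hR' := hR.card_le
  rw [Finset.card_erase_of_mem hmem] at hle
  exact ⟨(hS.1 _ hmem).2.2.2, k, ⟨hik, hkj⟩, hL.bRec_of_card_eq (by omega),
    hR.bRec_of_card_eq (by omega)⟩
termination_by j - i

/-- Noncrossing sets on the two sides of a vertex `k` combine with the chord `(i, j)`. -/
theorem IsNoncrossingOn.insert_union {A : ℕ → ℕ → Prop} {i k j : ℕ} {L R : Finset (ℕ × ℕ)}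
    (hL : IsNoncrossingOn A i k L) (hR : IsNoncrossingOn A k j R) (hik : i < k) (hkj : k < j)
    (hA : A i j) : IsNoncrossingOn A i j (insert (i, j) (L ∪ R)) ∧
      (insert (i, j) (L ∪ R)).card = L.card + R.card + 1 := by
  refine ⟨⟨?_, ?_⟩, ?_⟩
  · intro c hc
    simp only [Finset.mem_insert, Finset.mem_union] at hc
    rcases hc with rfl | hc | hc
    · exact ⟨le_rfl, by simp only; omega, le_rfl, hA⟩
    · obtain ⟨h₁, h₂, h₃, h₄⟩ := hL.1 c hc
      exact ⟨h₁, h₂, by omega, h₄⟩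
    · obtain ⟨h₁, h₂, h₃, h₄⟩ := hR.1 c hc
      exact ⟨by omega, h₂, h₃, h₄⟩
  · intro c hc d hd
    simp only [Finset.mem_insert, Finset.mem_union] at hc hd
    rcases hc with rfl | hc | hc <;> rcases hd with rfl | hd | hd
    · simp only [Crosses]; omega
    · have := hL.1 d hd
      simp only [Crosses]; omega
    · have := hR.1 d hd
      simp only [Crosses]; omega
    · have := hL.1 c hc
      simp only [Crosses]; omega
    · exact hL.2 c hc d hd
    · have := hL.1 c hc
      have := hR.1 d hd
      simp only [Crosses]; omega
    · have := hR.1 c hc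
      simp only [Crosses]; omega
    · have := hR.1 c hc
      have := hL.1 d hd
      simp only [Crosses]; omega
    · exact hR.2 c hc d hd
  · rw [Finset.card_insert_of_notMem, Finset.card_union_of_disjoint]
    · refine Finset.disjoint_left.2 fun c hc hc' ↦ ?_
      have := hL.1 c hc
      have := hR.1 c hc'
      omega
    · intro h
      rcases Finset.mem_union.1 h with h | h
      · have := hL.1 _ h
        simp only at this
        omega
      · have := hR.1 _ h
        simp only at this
        omega

/-- If `bRec` holds, there is a noncrossing set of chords of maximal size. -/
theorem exists_isNoncrossingOn_of_bRec {A : ℕ → ℕ → Prop} {i j : ℕ} (h : bRec A i j) :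
    ∃ S, IsNoncrossingOn A i j S ∧ S.card = j - i - 1 := by
  rw [bRec] at h
  split_ifs at h with hij
  · exact ⟨∅, ⟨by simp, by simp⟩, by rw [Finset.card_empty]; omega⟩
  · obtain ⟨hA, k, ⟨hik, hkj⟩, h₁, h₂⟩ := h
    obtain ⟨L, hL, hLc⟩ := exists_isNoncrossingOn_of_bRec h₁
    obtain ⟨R, hR, hRc⟩ := exists_isNoncrossingOn_of_bRec h₂
    obtain ⟨hS, hSc⟩ := hL.insert_union hR hik hkj hA
    exact ⟨_, hS, by omega⟩
termination_by j - i

/-- Removing `(i, j)` from a maximal noncrossing set leaves a triangulation. -/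
theorem IsNoncrossingOn.isTriangulationOn_erase {A : ℕ → ℕ → Prop} {i j : ℕ}
    {S : Finset (ℕ × ℕ)} (hS : IsNoncrossingOn A i j S) (hcard : S.card = j - i - 1)
    (hmem : (i, j) ∈ S) : IsTriangulationOn A i j (S.erase (i, j)) := by
  refine ⟨fun c hc ↦ ?_, fun c hc d hd _ ↦ hS.2 c (Finset.mem_of_mem_erase hc) d
    (Finset.mem_of_mem_erase hd), ?_⟩
  · obtain ⟨hne, hc⟩ := Finset.mem_erase.1 hc
    obtain ⟨h₁, h₂, h₃, h₄⟩ := hS.1 c hc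
    exact ⟨h₁, h₂, h₃, hne, h₄⟩
  · rw [Finset.card_erase_of_mem hmem]
    omega

/-- Adding `(i, j)` to a triangulation gives a maximal noncrossing set. -/
theorem IsTriangulationOn.isNoncrossingOn_insert {A : ℕ → ℕ → Prop} {i j : ℕ}
    {T : Finset (ℕ × ℕ)} (hT : IsTriangulationOn A i j T) (hA : A i j) (hij : i + 2 ≤ j) :
    IsNoncrossingOn A i j (insert (i, j) T) ∧ (insert (i, j) T).card = j - i - 1 := by
  obtain ⟨h₁, h₂, h₃⟩ := hT
  refine ⟨⟨?_, ?_⟩, ?_⟩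
  · intro c hc
    rcases Finset.mem_insert.1 hc with rfl | hc
    · exact ⟨le_rfl, hij, le_rfl, hA⟩
    · obtain ⟨g₁, g₂, g₃, -, g₄⟩ := h₁ c hc
      exact ⟨g₁, g₂, g₃, g₄⟩
  · intro c hc d hd
    rcases Finset.mem_insert.1 hc with rfl | hc <;> rcases Finset.mem_insert.1 hd with rfl | hd
    · simp only [Crosses]; omega
    · have := h₁ d hd
      simp only [Crosses]; omega
    · have := h₁ c hc
      simp only [Crosses]; omega
    · by_cases hcd : c = d
      · subst hcd
        simp only [Crosses]; omega
      · exact h₂ c hc d hd hcd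
  · rw [Finset.card_insert_of_notMem fun h ↦ (h₁ _ h).2.2.2.1 rfl]
    omega

/-- For all `0 ≤ i < j ≤ n-1`, `b(i,j)` holds iff `A(i,j)` holds and, in case
`j ≥ i+2`, there exists a triangulation of the subpolygon on vertices `i, …, j`
within `A` (for `j = i+1` the latter condition is vacuous). -/
theorem stmt_0 (n : ℕ) (hn : 2 ≤ n) (A : ℕ → ℕ → Prop)
    (hsymm : ∀ i j, A i j ↔ A j i)
    (hbd : ∀ i, i ≤ n - 2 → A i (i + 1))
    (i j : ℕ) (hij : i < j) (hjn : j ≤ n - 1) :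
    bRec A i j ↔
      A i j ∧ (i + 2 ≤ j → ∃ T : Finset (ℕ × ℕ), IsTriangulationOn A i j T) := by
  constructor
  · intro h
    by_cases hlong : i + 2 ≤ j
    · obtain ⟨S, hS, hcard⟩ := exists_isNoncrossingOn_of_bRec h
      have hmem := hS.mem_of_card_eq hcard hlong
      exact ⟨(hS.1 _ hmem).2.2.2, fun _ ↦ ⟨_, hS.isTriangulationOn_erase hcard hmem⟩⟩
    · obtain rfl : j = i + 1 := by omega
      exact ⟨hbd i (by omega), fun h ↦ absurd h hlong⟩
  · rintro ⟨hA, h⟩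
    by_cases hlong : i + 2 ≤ j
    · obtain ⟨T, hT⟩ := h hlong
      obtain ⟨hS, hcard⟩ := hT.isNoncrossingOn_insert hA hlong
      exact hS.bRec_of_card_eq hcard
    · rw [bRec, if_pos (by omega)]
      trivial
end

section
/- For n ≥ 3, the number of triangulations of the convex n-gon, i.e., the number of sets T of n−3 pairwise noncrossing diagonals (pairs (k,l) with 0 ≤ k, k+2 ≤ l ≤ n−1 and (k,l) ≠ (0,n−1)), equals the Catalan number C_{n−2}. -/
/-- `T` is a triangulation of the convex `n`-gon with vertices labeled
`0, …, n-1` counterclockwise: a set of `n - 3` pairwise noncrossing diagonals,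
a diagonal being a pair `(k,l)` with `0 ≤ k`, `k+2 ≤ l ≤ n-1` and `(k,l) ≠ (0,n-1)`. -/
def IsPolygonTriangulation (n : ℕ) (T : Finset (ℕ × ℕ)) : Prop :=
  (∀ c ∈ T, c.1 + 2 ≤ c.2 ∧ c.2 ≤ n - 1 ∧ c ≠ (0, n - 1)) ∧
  (∀ c ∈ T, ∀ d ∈ T, c ≠ d → ¬ Crosses c d) ∧
  T.card = n - 3

/-- The chords of the triangulation of the polygon on the vertices `a, …, a + t.numNodes + 1`
encoded by the binary tree `t`, including the edge joining the first and the last vertex. -/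
def treeChords : ℕ → BinaryTree Unit → Finset (ℕ × ℕ)
  | _, .nil => ∅
  | a, .node _ l r =>
    insert (a, a + (l.numNodes + r.numNodes + 1) + 1)
      (treeChords a l ∪ treeChords (a + l.numNodes + 1) r)

theorem mem_treeChords_node {a : ℕ} {u : Unit} {l r : BinaryTree Unit} {c : ℕ × ℕ} :
    c ∈ treeChords a (.node u l r) ↔
      c = (a, a + (l.numNodes + r.numNodes + 1) + 1) ∨ c ∈ treeChords a l ∨
        c ∈ treeChords (a + l.numNodes + 1) r := by
  simp [treeChords]

theorem treeChords_bounds {t : BinaryTree Unit} {a : ℕ} {c : ℕ × ℕ} (hc : c ∈ treeChords a t) :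
    a ≤ c.1 ∧ c.1 + 2 ≤ c.2 ∧ c.2 ≤ a + t.numNodes + 1 := by
  induction t generalizing a with
  | nil => simp [treeChords] at hc
  | node u l r ihl ihr =>
    simp only [BinaryTree.numNodes]
    rcases mem_treeChords_node.1 hc with rfl | h | h
    · dsimp only; omega
    · have := ihl h; omega
    · have := ihr h; omega

theorem root_mem_treeChords {t : BinaryTree Unit} (a : ℕ) (ht : 0 < t.numNodes) :
    (a, a + t.numNodes + 1) ∈ treeChords a t := by
  cases t with
  | nil => simp at ht
  | node u l r => exact mem_treeChords_node.2 (Or.inl rfl)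

theorem not_crosses_of_mem_treeChords {t : BinaryTree Unit} {a : ℕ} {c d : ℕ × ℕ}
    (hc : c ∈ treeChords a t) (hd : d ∈ treeChords a t) : ¬ Crosses c d := by
  induction t generalizing a with
  | nil => simp [treeChords] at hc
  | node u l r ihl ihr =>
    have hc' := treeChords_bounds hc
    have hd' := treeChords_bounds hd
    simp only [BinaryTree.numNodes] at hc' hd'
    rcases mem_treeChords_node.1 hc with rfl | h | h <;>
    rcases mem_treeChords_node.1 hd with rfl | k | k
    case inr.inl.inr.inl => exact ihl h k
    case inr.inr.inr.inr => exact ihr h k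
    case inr.inl.inr.inr =>
      have := treeChords_bounds h
      have := treeChords_bounds k
      unfold Crosses; omega
    case inr.inr.inr.inl =>
      have := treeChords_bounds h
      have := treeChords_bounds k
      unfold Crosses; omega
    all_goals (unfold Crosses; dsimp only at *; omega)

theorem card_treeChords (a : ℕ) (t : BinaryTree Unit) : (treeChords a t).card = t.numNodes := by
  induction t generalizing a with
  | nil => simp [treeChords]
  | node u l r ihl ihr =>
    rw [treeChords, Finset.card_insert_of_notMem, Finset.card_union_of_disjoint, ihl, ihr,
      BinaryTree.numNodes]
    · refine Finset.disjoint_left.2 fun c hl hr => ?_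
      have := treeChords_bounds hl
      have := treeChords_bounds hr
      omega
    · intro h
      rcases Finset.mem_union.1 h with h | h
      · have := treeChords_bounds h
        dsimp only at this; omega
      · have := treeChords_bounds h
        dsimp only at this; omega

theorem numNodes_left_le_of_treeChords_subset {a : ℕ} {u u' : Unit} {l r l' r' : BinaryTree Unit}
    (h : treeChords a (.node u l' r') ⊆ treeChords a (.node u' l r))
    (hn : l'.numNodes + r'.numNodes = l.numNodes + r.numNodes) :
    l'.numNodes ≤ l.numNodes := by
  by_contra! hlt
  have hmem := h (mem_treeChords_node.2 (Or.inr (Or.inl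
    (root_mem_treeChords a (Nat.zero_lt_of_lt hlt)))))
  rcases mem_treeChords_node.1 hmem with h | h | h
  · have := congrArg Prod.snd h
    dsimp only at this; omega
  · have := treeChords_bounds h
    dsimp only at this; omega
  · have := treeChords_bounds h
    dsimp only at this; omega

theorem treeChords_injective (a : ℕ) {t t' : BinaryTree Unit}
    (h : treeChords a t = treeChords a t') : t = t' := by
  induction t generalizing a t' with
  | nil =>
    have hc := congrArg Finset.card h
    rw [card_treeChords, card_treeChords] at hc
    cases t' with
    | nil => rfl
    | node => simp at hc
  | node u l r ihl ihr =>
    have hc := congrArg Finset.card h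
    rw [card_treeChords, card_treeChords] at hc
    cases t' with
    | nil => simp at hc
    | node u' l' r' =>
      simp only [BinaryTree.numNodes] at hc
      have hl : l.numNodes = l'.numNodes :=
        le_antisymm (numNodes_left_le_of_treeChords_subset h.subset (by omega))
          (numNodes_left_le_of_treeChords_subset h.superset (by omega))
      have hr : r.numNodes = r'.numNodes := by omega
      have key (c : ℕ × ℕ) := Finset.ext_iff.1 h c
      simp only [mem_treeChords_node, ← hl, ← hr] at key
      have hL : treeChords a l = treeChords a l' := by
        ext c
        constructor <;> intro hm
        · rcases (key c).1 (Or.inr (Or.inl hm)) with rfl | k | k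
          · have := treeChords_bounds hm
            dsimp only at this; omega
          · exact k
          · have := treeChords_bounds hm
            have := treeChords_bounds k
            omega
        · rcases (key c).2 (Or.inr (Or.inl hm)) with rfl | k | k
          · have := treeChords_bounds hm
            dsimp only at this; omega
          · exact k
          · have := treeChords_bounds hm
            have := treeChords_bounds k
            omega
      have hR : treeChords (a + l.numNodes + 1) r = treeChords (a + l.numNodes + 1) r' := by
        ext c
        constructor <;> intro hm
        · rcases (key c).1 (Or.inr (Or.inr hm)) with rfl | k | k
          · have := treeChords_bounds hm
            dsimp only at this; omega
          · have := treeChords_bounds hm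
            have := treeChords_bounds k
            omega
          · exact k
        · rcases (key c).2 (Or.inr (Or.inr hm)) with rfl | k | k
          · have := treeChords_bounds hm
            dsimp only at this; omega
          · have := treeChords_bounds hm
            have := treeChords_bounds k
            omega
          · exact k
      rw [ihl a hL, ihr _ hR]

/-- A vertex `c` such that no chord of the noncrossing set `T` on `a, …, b`, other than `(a, b)`,
separates `c` from both `a` and `b`. -/
theorem exists_apex {T : Finset (ℕ × ℕ)} {a b : ℕ} (hab : a + 2 ≤ b)
    (hT : ∀ c ∈ T, a ≤ c.1 ∧ c.1 + 2 ≤ c.2 ∧ c.2 ≤ b)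
    (hcr : ∀ c ∈ T, ∀ d ∈ T, c ≠ d → ¬ Crosses c d) :
    ∃ c, a < c ∧ c < b ∧ ∀ d ∈ T, d = (a, b) ∨ d.2 ≤ c ∨ c ≤ d.1 := by
  let P : ℕ → Prop := fun l => l = a + 1 ∨ (a, l) ∈ T
  have hP : P (a + 1) := Or.inl rfl
  have hle : a + 1 ≤ b - 1 := by omega
  have hmax {l : ℕ} (hl : l ≤ b - 1) (h : P l) : l ≤ Nat.findGreatest P (b - 1) :=
    Nat.le_findGreatest hl h
  have hspec : P (Nat.findGreatest P (b - 1)) := Nat.findGreatest_spec hle hP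
  have hc := Nat.findGreatest_le (P := P) (b - 1)
  have hac := hmax hle hP
  generalize Nat.findGreatest P (b - 1) = c at *
  refine ⟨c, by omega, by omega, ?_⟩
  rintro ⟨k, l⟩ hd
  by_contra! hcon
  obtain ⟨hne, hcl, hkc⟩ := hcon
  have hb := hT _ hd
  dsimp only at hb hcl hkc
  rcases hb.1.eq_or_lt with rfl | hak
  · rcases hb.2.2.eq_or_lt with rfl | hlb
    · exact hne rfl
    · have := hmax (by omega) (Or.inr hd)
      omega
  · rcases hspec with h | h
    · omega
    · refine hcr _ h _ hd (fun he => ?_) (Or.inl ⟨hak, hkc, hcl⟩)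
      have := congrArg Prod.fst he
      dsimp only at this; omega

theorem exists_subset_treeChords (m : ℕ) (a : ℕ) (T : Finset (ℕ × ℕ))
    (hT : ∀ c ∈ T, a ≤ c.1 ∧ c.1 + 2 ≤ c.2 ∧ c.2 ≤ a + m + 1)
    (hcr : ∀ c ∈ T, ∀ d ∈ T, c ≠ d → ¬ Crosses c d) :
    ∃ t : BinaryTree Unit, t.numNodes = m ∧ T ⊆ treeChords a t := by
  induction m using Nat.strong_induction_on generalizing a T with
  | _ m ih =>
    rcases Nat.eq_zero_or_pos m with rfl | hm
    · refine ⟨.nil, rfl, fun c hc => ?_⟩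
      have := hT c hc
      omega
    obtain ⟨v, hav, hvb, hv⟩ := exists_apex (by omega) hT hcr
    obtain ⟨i, rfl⟩ : ∃ i, v = a + i + 1 := ⟨v - a - 1, by omega⟩
    obtain ⟨j, rfl⟩ : ∃ j, m = i + j + 1 := ⟨m - i - 1, by omega⟩
    obtain ⟨l, rfl, hl⟩ := ih i (by omega) a (T.filter fun c => c.2 ≤ a + i + 1)
      (fun c hc => by
        rw [Finset.mem_filter] at hc
        have := hT c hc.1
        omega)
      (fun c hc d hd => hcr c (Finset.mem_filter.1 hc).1 d (Finset.mem_filter.1 hd).1)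
    obtain ⟨r, rfl, hr⟩ := ih j (by omega) (a + l.numNodes + 1)
      (T.filter fun c => a + l.numNodes + 1 ≤ c.1)
      (fun c hc => by
        rw [Finset.mem_filter] at hc
        have := hT c hc.1
        omega)
      (fun c hc d hd => hcr c (Finset.mem_filter.1 hc).1 d (Finset.mem_filter.1 hd).1)
    refine ⟨.node () l r, rfl, fun c hc => mem_treeChords_node.2 ?_⟩
    rcases hv c hc with h | h | h
    · exact Or.inl h
    · exact Or.inr (Or.inl (hl (Finset.mem_filter.2 ⟨hc, h⟩)))
    · exact Or.inr (Or.inr (hr (Finset.mem_filter.2 ⟨hc, h⟩)))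

theorem setOf_isPolygonTriangulation_eq_image (m : ℕ) :
    {T | IsPolygonTriangulation (m + 3) T} =
      (fun t => (treeChords 0 t).erase (0, m + 2)) ''
        (BinaryTree.treesOfNumNodesEq (m + 1) : Set (BinaryTree Unit)) := by
  ext T
  simp only [Set.mem_ofPred_eq, Set.mem_image, Finset.mem_coe, BinaryTree.mem_treesOfNumNodesEq]
  constructor
  · rintro ⟨hT, hcr, hcard⟩
    have hroot : (0, m + 2) ∉ T := fun h => (hT _ h).2.2 rfl
    obtain ⟨t, ht, hsub⟩ := exists_subset_treeChords (m + 1) 0 (insert (0, m + 2) T)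
      (fun c hc => by
        rcases Finset.mem_insert.1 hc with rfl | hc
        · dsimp only; omega
        · have := hT c hc
          omega)
      (fun c hc d hd hne => by
        rcases Finset.mem_insert.1 hc with rfl | hc' <;>
        rcases Finset.mem_insert.1 hd with rfl | hd'
        · exact absurd rfl hne
        · have := hT d hd'
          unfold Crosses; dsimp only; omega
        · have := hT c hc'
          unfold Crosses; dsimp only; omega
        · exact hcr c hc' d hd' hne)
    refine ⟨t, ht, ?_⟩
    rw [← Finset.eq_of_subset_of_card_le hsub, Finset.erase_insert hroot]
    rw [card_treeChords, Finset.card_insert_of_notMem hroot]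
    omega
  · rintro ⟨t, ht, rfl⟩
    refine ⟨fun c hc => ?_, fun c hc d hd _ => not_crosses_of_mem_treeChords
      (Finset.mem_of_mem_erase hc) (Finset.mem_of_mem_erase hd), ?_⟩
    · have := treeChords_bounds (Finset.mem_of_mem_erase hc)
      exact ⟨this.2.1, by omega, Finset.ne_of_mem_erase hc⟩
    · have := root_mem_treeChords (t := t) 0 (by omega)
      rw [ht, show 0 + (m + 1) + 1 = m + 2 by omega] at this
      rw [Finset.card_erase_of_mem this, card_treeChords, ht]
      omega

/-- For `n ≥ 3`, the number of triangulations of the convex `n`-gon equals the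
Catalan number `C_{n-2}`. -/
theorem stmt_3 (n : ℕ) (hn : 3 ≤ n) :
    {T : Finset (ℕ × ℕ) | IsPolygonTriangulation n T}.ncard = catalan (n - 2) := by
  obtain ⟨m, rfl⟩ : ∃ m, n = m + 3 := ⟨n - 3, by omega⟩
  rw [setOf_isPolygonTriangulation_eq_image, Set.InjOn.ncard_image, Set.ncard_coe_finset,
    BinaryTree.treesOfNumNodesEq_card_eq_catalan]
  · rfl
  · intro t ht t' ht' h
    rw [Finset.mem_coe, BinaryTree.mem_treesOfNumNodesEq] at ht ht'
    have hmem {s : BinaryTree Unit} (hs : s.numNodes = m + 1) : (0, m + 2) ∈ treeChords 0 s := by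
      have := root_mem_treeChords (t := s) 0 (by omega)
      rwa [hs, show 0 + (m + 1) + 1 = m + 2 by omega] at this
    apply treeChords_injective 0
    rw [← Finset.insert_erase (hmem ht), ← Finset.insert_erase (hmem ht')]
    exact congrArg (insert (0, m + 2)) h
end

section
/- Let n ≥ 3 and let T be a triangulation of the convex n-gon, i.e., a set of n−3 pairwise noncrossing diagonals, and let E = T ∪ {(i,i+1) : 0 ≤ i ≤ n−2} ∪ {(0,n−1)}. Then for every pair (i,j) ∈ E with j ≥ i+2, there exists exactly one index k with i < k < j such that (i,k) ∈ E and (k,j) ∈ E. -/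
/-- A pairwise noncrossing family of chords of span at least two on the vertices `a, …, b`
has at most `b - a - 1` members. -/
theorem card_add_one_le_of_not_crosses (a b : ℕ) (hab : a < b) (S : Finset (ℕ × ℕ))
    (hS : ∀ c ∈ S, a ≤ c.1 ∧ c.1 + 2 ≤ c.2 ∧ c.2 ≤ b)
    (hc : ∀ c ∈ S, ∀ d ∈ S, ¬ Crosses c d) : S.card + 1 ≤ b - a := by
  induction hm : b - a using Nat.strong_induction_on generalizing a b S with
  | _ m ih =>
    subst hm
    rcases Nat.lt_or_ge b (a + 2) with hb | hb
    · have : S = ∅ := Finset.eq_empty_of_forall_notMem fun c hcS => by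
        have := hS c hcS
        omega
      simp only [this, Finset.card_empty]
      omega
    -- the last neighbour `k` of `a` before `b` splits the family
    obtain ⟨k, hk, hkb, hmax⟩ : ∃ k, ((a, k) ∈ S ∨ k = a + 1) ∧ k < b ∧
        ∀ l, (a, l) ∈ S → l < b → l ≤ k := by
      classical
      let P : ℕ → Prop := fun l => ((a, l) ∈ S ∨ l = a + 1) ∧ l < b
      have hP : P (a + 1) := ⟨Or.inr rfl, by omega⟩
      have hle : a + 1 ≤ b := by omega
      have hg : P (Nat.findGreatest P b) := Nat.findGreatest_spec hle hP
      exact ⟨_, hg.1, hg.2, fun l hl hlb => Nat.le_findGreatest hlb.le ⟨Or.inl hl, hlb⟩⟩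
    have hak : a < k := by
      rcases hk with hk | hk
      · have := hS _ hk
        simp only at this
        omega
      · omega
    have hleft := ih (k - a) (by omega) a k hak (S.filter fun c => c.2 ≤ k)
      (fun c h => by
        rw [Finset.mem_filter] at h
        have := hS c h.1
        omega)
      (fun c h d h' => hc c (Finset.mem_filter.1 h).1 d (Finset.mem_filter.1 h').1) rfl
    have hright := ih (b - k) (by omega) k b hkb (S.filter fun c => k ≤ c.1)
      (fun c h => by
        rw [Finset.mem_filter] at h
        have := hS c h.1
        omega)
      (fun c h d h' => hc c (Finset.mem_filter.1 h).1 d (Finset.mem_filter.1 h').1) rfl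
    have hcover : S ⊆ insert (a, b) ((S.filter fun c => c.2 ≤ k) ∪ S.filter fun c => k ≤ c.1) := by
      rintro ⟨x, y⟩ hxy
      have hb' := hS _ hxy
      simp only [Finset.mem_insert, Finset.mem_union, Finset.mem_filter, hxy, true_and,
        Prod.mk.injEq]
      simp only at hb'
      by_contra! hcon
      obtain ⟨hne, hky, hxk⟩ := hcon
      rcases Nat.eq_or_lt_of_le hb'.1 with rfl | hax
      · have := hmax y hxy
        have := hne rfl
        omega
      · rcases hk with hk | hk
        · exact hc _ hk _ hxy (Or.inl ⟨hax, hxk, hky⟩)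
        · omega
    have h1 := Finset.card_le_card hcover
    have h2 := Finset.card_insert_le (a, b)
      ((S.filter fun c => c.2 ≤ k) ∪ S.filter fun c => k ≤ c.1)
    have h3 := Finset.card_union_le (S.filter fun c => c.2 ≤ k) (S.filter fun c => k ≤ c.1)
    omega

/-- A triangulation is maximal: every diagonal outside it crosses one of its members. -/
theorem IsPolygonTriangulation.exists_crosses {n : ℕ} (hn : 3 ≤ n) {T : Finset (ℕ × ℕ)}
    (hT : IsPolygonTriangulation n T) {d : ℕ × ℕ} (hd : d.1 + 2 ≤ d.2) (hdn : d.2 ≤ n - 1)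
    (hd0 : d ≠ (0, n - 1)) (hdT : d ∉ T) : ∃ c ∈ T, Crosses c d := by
  obtain ⟨hdiag, hnc, hcard⟩ := hT
  by_contra! hcon
  have hbound : ∀ c ∈ insert (0, n - 1) (insert d T),
      0 ≤ c.1 ∧ c.1 + 2 ≤ c.2 ∧ c.2 ≤ n - 1 := by
    intro c hc
    rw [Finset.mem_insert, Finset.mem_insert] at hc
    rcases hc with rfl | rfl | hc
    · simp only
      omega
    · omega
    · have := hdiag c hc
      omega
  have hcross : ∀ c ∈ insert (0, n - 1) (insert d T), ∀ e ∈ insert (0, n - 1) (insert d T),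
      ¬ Crosses c e := by
    intro c hc e he hce
    have hc' := hbound c hc
    have he' := hbound e he
    rw [Finset.mem_insert, Finset.mem_insert] at hc he
    rcases hc with rfl | hc
    · unfold Crosses at hce
      simp only at hce
      omega
    rcases he with rfl | he
    · unfold Crosses at hce
      simp only at hce
      omega
    rcases hc with rfl | hc <;> rcases he with rfl | he
    · unfold Crosses at hce
      omega
    · exact hcon e he (Or.symm hce)
    · exact hcon c hc hce
    · refine hnc c hc e he ?_ hce
      rintro rfl
      unfold Crosses at hce
      omega
  have hle := card_add_one_le_of_not_crosses 0 (n - 1) (by omega) _ hbound hcross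
  rw [Finset.card_insert_of_notMem, Finset.card_insert_of_notMem hdT] at hle
  · omega
  · rw [Finset.mem_insert]
    rintro (h | h)
    · exact hd0 h.symm
    · exact (hdiag _ h).2.2 rfl

/-- Let `T` be a triangulation of the convex `n`-gon (`n ≥ 3`) and let
`E = T ∪ {(i,i+1) : 0 ≤ i ≤ n-2} ∪ {(0,n-1)}`.  Then for every `(i,j) ∈ E` with
`j ≥ i+2` there is exactly one `k` with `i < k < j`, `(i,k) ∈ E` and `(k,j) ∈ E`. -/
theorem stmt_5 (n : ℕ) (hn : 3 ≤ n) (T : Finset (ℕ × ℕ))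
    (hT : IsPolygonTriangulation n T)
    (E : Finset (ℕ × ℕ))
    (hE : E = T ∪ (Finset.range (n - 1)).image (fun i => (i, i + 1)) ∪ {(0, n - 1)})
    (i j : ℕ) (hij : (i, j) ∈ E) (h2 : i + 2 ≤ j) :
    ∃! k, (i < k ∧ k < j) ∧ (i, k) ∈ E ∧ (k, j) ∈ E := by
  have hmem : ∀ a b, (a, b) ∈ E ↔
      (a, b) ∈ T ∨ (b = a + 1 ∧ a < n - 1) ∨ (a = 0 ∧ b = n - 1) := by
    intro a b
    simp only [hE, Finset.mem_union, Finset.mem_image, Finset.mem_range, Finset.mem_singleton,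
      Prod.mk.injEq, or_assoc]
    refine or_congr_right (or_congr_left ⟨?_, ?_⟩)
    · rintro ⟨x, hx, rfl, rfl⟩
      exact ⟨rfl, hx⟩
    · rintro ⟨rfl, h⟩
      exact ⟨a, h, rfl, rfl⟩
  have hlt : ∀ a b, (a, b) ∈ E → a < b ∧ b ≤ n - 1 := by
    intro a b h
    rcases (hmem a b).1 h with h | h | h
    · have := hT.1 _ h
      simp only at this
      omega
    · omega
    · omega
  have hnc : ∀ a b c d, (a, b) ∈ E → (c, d) ∈ E → a < c → c < b → b < d → False := by
    intro a b c d h h' h1 h2 h3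
    have hb := hlt _ _ h
    have hd := hlt _ _ h'
    rcases (hmem a b).1 h with h | h | h
    · rcases (hmem c d).1 h' with h' | h' | h'
      · refine hT.2.1 _ h _ h' ?_ (Or.inl ⟨h1, h2, h3⟩)
        simp only [ne_eq, Prod.mk.injEq]
        omega
      · omega
      · omega
    · omega
    · omega
  have hj := hlt _ _ hij
  obtain ⟨k, hik, hkj, hmax⟩ : ∃ k, (i, k) ∈ E ∧ k < j ∧ ∀ l, (i, l) ∈ E → l < j → l ≤ k := by
    let P : ℕ → Prop := fun l => (i, l) ∈ E ∧ l < j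
    have hP : P (i + 1) := ⟨(hmem _ _).2 (Or.inr (Or.inl ⟨rfl, by omega⟩)), by omega⟩
    have hg : P (Nat.findGreatest P j) := Nat.findGreatest_spec (by omega) hP
    exact ⟨_, hg.1, hg.2, fun l hl hlj => Nat.le_findGreatest hlj.le ⟨hl, hlj⟩⟩
  have hlt_ik := hlt _ _ hik
  have hkjE : (k, j) ∈ E := by
    by_contra hcon
    have hcon' := hcon
    rw [hmem] at hcon'
    push Not at hcon'
    obtain ⟨hkjT, hside, -⟩ := hcon'
    have hspan : k + 2 ≤ j := by
      by_contra hlt2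
      have := hside (by omega)
      omega
    obtain ⟨⟨a, b⟩, hab, hcr⟩ := hT.exists_crosses hn (d := (k, j)) hspan hj.2
      (by simp only [ne_eq, Prod.mk.injEq]; omega) hkjT
    have habE := (hmem a b).2 (Or.inl hab)
    rcases hcr with ⟨h1, h3, h4⟩ | ⟨h1, h3, h4⟩
    · simp only at h1 h3 h4
      rcases lt_trichotomy a i with h | rfl | h
      · exact hnc _ _ _ _ habE hij h (by omega) h4
      · have := hmax b habE h4
        omega
      · exact hnc _ _ _ _ hik habE h h1 h3
    · simp only at h1 h3 h4
      exact hnc _ _ _ _ hij habE (by omega) h3 h4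
  refine ⟨k, ⟨⟨hlt_ik.1, hkj⟩, hik, hkjE⟩, ?_⟩
  rintro l ⟨⟨hil, hlj⟩, hilE, hljE⟩
  refine le_antisymm (hmax l hilE hlj) (not_lt.1 fun hlk => ?_)
  exact hnc _ _ _ _ hik hljE hil hlk hkj
end

section
/- Let R₁ and R₂ be closed subsets of the Euclidean plane ℝ², let a, b ∈ ℝ², let d be the segment [a,b], and assume R₁ ∩ R₂ = d. Let v ∈ R₁ \ d and w ∈ R₂ \ d, and assume that the intersection of the segments [v,w] and [a,b] contains at most one point. Then [v,w] ⊆ R₁ ∪ R₂ if and only if there exists a point x ∈ [v,w] ∩ [a,b] such that [v,x] ⊆ R₁ and [x,w] ⊆ R₂. -/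
/-- A segment joining two closed sets and covered by them meets their intersection. -/
theorem exists_mem_segment_inter_of_isClosed {E : Type*} [AddCommGroup E] [Module ℝ E]
    [TopologicalSpace E] [ContinuousAdd E] [ContinuousSMul ℝ E] {s t : Set E}
    (hs : IsClosed s) (ht : IsClosed t) {p q : E} (hp : p ∈ s) (hq : q ∈ t)
    (h : segment ℝ p q ⊆ s ∪ t) : ∃ z ∈ segment ℝ p q, z ∈ s ∩ t :=
  isPreconnected_closed_iff.1 (convex_segment p q).isPreconnected s t hs ht h
    ⟨p, left_mem_segment ℝ p q, hp⟩ ⟨q, right_mem_segment ℝ p q, hq⟩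

/-- If a segment covered by two closed sets meets their intersection at most at `x`, the part of
the segment from an endpoint in the first set up to `x` lies in the first set. -/
theorem segment_subset_of_inter_subsingleton {E : Type*} [AddCommGroup E] [Module ℝ E]
    [TopologicalSpace E] [ContinuousAdd E] [ContinuousSMul ℝ E] {s t : Set E}
    (hs : IsClosed s) (ht : IsClosed t) {p q x : E} (hp : p ∈ s)
    (h : segment ℝ p q ⊆ s ∪ t) (hone : (segment ℝ p q ∩ (s ∩ t)).Subsingleton)
    (hx : x ∈ segment ℝ p q) (hxs : x ∈ s ∩ t) : segment ℝ p x ⊆ s := by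
  intro y hy
  by_contra hys
  have hyq : y ∈ segment ℝ p q :=
    (convex_segment p q).segment_subset (left_mem_segment ℝ p q) hx hy
  have hsub : segment ℝ p y ⊆ segment ℝ p q :=
    (convex_segment p q).segment_subset (left_mem_segment ℝ p q) hyq
  obtain ⟨z, hz, hzs⟩ := exists_mem_segment_inter_of_isClosed hs ht hp
    ((h hyq).resolve_left hys) (hsub.trans h)
  obtain rfl : z = x := hone ⟨hsub hz, hzs⟩ ⟨hx, hxs⟩
  have hyz : y = z := (wbtw_swap_right_iff ℝ p).1
    ⟨mem_segment_iff_wbtw.1 hy, mem_segment_iff_wbtw.1 hz⟩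
  exact hys (hyz ▸ hxs.1)

/-- A point of a segment splits it into two segments covering it. -/
theorem segment_subset_union_of_mem {E : Type*} [AddCommGroup E] [Module ℝ E] {p q x : E}
    (hx : x ∈ segment ℝ p q) : segment ℝ p q ⊆ segment ℝ p x ∪ segment ℝ x q := by
  rw [segment_eq_image_lineMap] at hx
  obtain ⟨r, hr, rfl⟩ := hx
  intro y hy
  rw [segment_eq_image_lineMap] at hy
  obtain ⟨u, hu, rfl⟩ := hy
  rcases le_total u r with hur | hru
  · left
    have hmem : u ∈ segment ℝ 0 r := by
      rw [segment_eq_Icc hr.1]; exact ⟨hu.1, hur⟩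
    simpa using (mem_segment_iff_wbtw.2
      ((mem_segment_iff_wbtw.1 hmem).map (AffineMap.lineMap p q)))
  · right
    have hmem : u ∈ segment ℝ r 1 := by
      rw [segment_eq_Icc hr.2]; exact ⟨hru, hu.2⟩
    simpa using (mem_segment_iff_wbtw.2
      ((mem_segment_iff_wbtw.1 hmem).map (AffineMap.lineMap p q)))


/-- Let `R₁`, `R₂` be closed subsets of the Euclidean plane with
`R₁ ∩ R₂ = [a,b]`, let `v ∈ R₁ \ [a,b]` and `w ∈ R₂ \ [a,b]`, and assume the
segments `[v,w]` and `[a,b]` meet in at most one point.  Then `[v,w] ⊆ R₁ ∪ R₂`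
iff there is a point `x ∈ [v,w] ∩ [a,b]` with `[v,x] ⊆ R₁` and `[x,w] ⊆ R₂`. -/
theorem stmt_10 (R₁ R₂ : Set (EuclideanSpace ℝ (Fin 2)))
    (hR₁ : IsClosed R₁) (hR₂ : IsClosed R₂)
    (a b : EuclideanSpace ℝ (Fin 2))
    (hd : R₁ ∩ R₂ = segment ℝ a b)
    (v w : EuclideanSpace ℝ (Fin 2))
    (hv : v ∈ R₁ \ segment ℝ a b) (hw : w ∈ R₂ \ segment ℝ a b)
    (hone : (segment ℝ v w ∩ segment ℝ a b).Subsingleton) :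
    segment ℝ v w ⊆ R₁ ∪ R₂ ↔
      ∃ x ∈ segment ℝ v w ∩ segment ℝ a b,
        segment ℝ v x ⊆ R₁ ∧ segment ℝ x w ⊆ R₂ := by
  constructor
  · intro h
    obtain ⟨x, hx, hxs⟩ := exists_mem_segment_inter_of_isClosed hR₁ hR₂ hv.1 hw.1 h
    rw [← hd] at hone
    refine ⟨x, ⟨hx, hd ▸ hxs⟩,
      segment_subset_of_inter_subsingleton hR₁ hR₂ hv.1 h hone hx hxs, ?_⟩
    rw [segment_symm ℝ v w] at h hone hx
    rw [Set.union_comm] at h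
    rw [Set.inter_comm R₁ R₂] at hone hxs
    rw [segment_symm ℝ x w]
    exact segment_subset_of_inter_subsingleton hR₂ hR₁ hw.1 h hone hx hxs
  · rintro ⟨x, ⟨hx, -⟩, h₁, h₂⟩
    exact (segment_subset_union_of_mem hx).trans (Set.union_subset_union h₁ h₂)
end
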